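/- arXiv:2405.13942 — 2 statements merged into one kernel-verified Lean document; each statement's English description precedes it below -/
import Mathlib

section
/- (Rank Lemma, abstract form) Let R be a linearly ordered commutative ring, let c ∈ R be nonstandard (i.e. (n : R) < c for every natural number n), let W be a linear order whose strict order relation is well-founded, and let r : R → W be a function such that for every a ∈ R with 0 ≤ a and a < c, if r(a) is not a maximal element of W then r(a) < r(a + 1). Then there exists a ∈ R with 0 ≤ a ≤ c such that r(a) is a maximal element of W. -/
theorem rank_lemma
    (R : Type*) [CommRing R] [LinearOrder R] [IsStrictOrderedRing R]
    (c : R) (hc : ∀ n : ℕ, (n : R) < c)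
    (W : Type*) [LinearOrder W]
    (hW : WellFounded ((· < ·) : W → W → Prop))
    (r : R → W)
    (hr : ∀ a : R, 0 ≤ a → a < c → (∃ w : W, r a < w) → r a < r (a + 1)) :
    ∃ a : R, 0 ≤ a ∧ a ≤ c ∧ ¬ ∃ w : W, r a < w := by
  by_contra hcon
  have hmax : ∀ a : R, 0 ≤ a → a ≤ c → ∃ w : W, r a < w := fun a h0 h1 => by
    by_contra h
    exact hcon ⟨a, h0, h1, h⟩
  have hdesc : ∀ n : ℕ, r (c - (n + 1 : ℕ)) < r (c - n) := fun n => by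
    have h0 : (0 : R) ≤ c - (n + 1 : ℕ) := sub_nonneg.2 (hc _).le
    have h1 : c - (n + 1 : ℕ) < c := sub_lt_self c (by exact_mod_cast n.succ_pos)
    have h := hr _ h0 h1 (hmax _ h0 h1.le)
    rwa [show c - ((n + 1 : ℕ) : R) + 1 = c - n by push_cast; ring] at h
  obtain ⟨_, ⟨n, rfl⟩, hmin⟩ :=
    hW.has_min (Set.range fun n : ℕ => r (c - n)) (Set.range_nonempty _)
  exact hmin _ ⟨n + 1, rfl⟩ (hdesc n)
end

section
/- (Descending chain below a nonstandard element) Let R be a linearly ordered commutative ring, let c ∈ R be nonstandard (i.e. (n : R) < c for every natural number n), let W be a linear order, and let r : R → W be a function such that for every a ∈ R with 0 ≤ a and a < c, if r(a) is not a maximal element of W then r(a) < r(a + 1). Assume that r(a) is not a maximal element of W for any a ∈ R with 0 ≤ a ≤ c. Then for any nonstandard a ∈ R with a ≤ c, the sequence n ↦ r(a - (n : R)) (for n ∈ ℕ) is strictly antitone, i.e. r(a - (m : R)) < r(a - (n : R)) whenever n < m. -/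
theorem descending_chain_below_nonstandard
    (R : Type*) [CommRing R] [LinearOrder R] [IsStrictOrderedRing R]
    (c : R) (hc : ∀ n : ℕ, (n : R) < c)
    (W : Type*) [LinearOrder W]
    (r : R → W)
    (hr : ∀ a : R, 0 ≤ a → a < c → (∃ w : W, r a < w) → r a < r (a + 1))
    (hnomax : ∀ a : R, 0 ≤ a → a ≤ c → ∃ w : W, r a < w) :
    ∀ a : R, (∀ n : ℕ, (n : R) < a) → a ≤ c →
      StrictAnti (fun n : ℕ => r (a - (n : R))) := by
  intro a ha hac
  refine strictAnti_nat_of_succ_lt fun n => ?_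
  have hpos : 0 ≤ a - ((n + 1 : ℕ) : R) := sub_nonneg.mpr (ha (n + 1)).le
  have hlt : a - ((n + 1 : ℕ) : R) < c :=
    (sub_lt_self a (Nat.cast_pos.mpr n.succ_pos)).trans_le hac
  have hstep := hr _ hpos hlt (hnomax _ hpos hlt.le)
  have heq : a - ((n + 1 : ℕ) : R) + 1 = a - (n : R) := by
    push_cast
    ring
  rwa [heq] at hstep
end
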